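/- There exists exactly one bias vector b* : U → ℝ with T(b*) = b* (existence and uniqueness of the fixed point of the bias-update map). -/

import Mathlib

open Finset

noncomputable def clamp (x : ℝ) : ℝ := max 0 (min 1 x)

/-- The set of users rating object `j`. -/
def dminus {U O : Type} [Fintype U] [DecidableEq O] (dplus : U → Finset O) (j : O) :
    Finset U :=
  Finset.univ.filter (fun i => j ∈ dplus i)

/-- The true-rating map `R(b)`. -/
noncomputable def Rmap {U O : Type} [Fintype U] [DecidableEq O] (dplus : U → Finset O)
    (w : U → O → ℝ) (α : ℝ) (b : U → ℝ) (j : O) : ℝ :=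
  (∑ i ∈ dminus dplus j, clamp (w i j - α * b i)) / (dminus dplus j).card

/-- The bias-update map `T(b)`. -/
noncomputable def Tmap {U O : Type} [Fintype U] [DecidableEq O] (dplus : U → Finset O)
    (w : U → O → ℝ) (α : ℝ) (b : U → ℝ) (i : U) : ℝ :=
  (∑ j ∈ dplus i, (w i j - Rmap dplus w α b j)) / (dplus i).card

lemma abs_clamp_sub_clamp_le (x y : ℝ) : |clamp x - clamp y| ≤ |x - y| := by
  unfold clamp
  calc |max 0 (min 1 x) - max 0 (min 1 y)| ≤ max |(0 : ℝ) - 0| |min 1 x - min 1 y| :=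
        abs_max_sub_max_le_max _ _ _ _
    _ = |min 1 x - min 1 y| := by simp
    _ ≤ max |(1 : ℝ) - 1| |x - y| := abs_min_sub_min_le_max _ _ _ _
    _ = |x - y| := by simp

/-- If two families are pointwise within `C` of each other, then so are their averages. -/
lemma abs_average_sub_average_le {ι : Type*} {s : Finset ι} (hs : s.Nonempty) {f g : ι → ℝ}
    {C : ℝ} (h : ∀ i ∈ s, |f i - g i| ≤ C) :
    |(∑ i ∈ s, f i) / s.card - (∑ i ∈ s, g i) / s.card| ≤ C := by
  have hc : (0 : ℝ) < s.card := by exact_mod_cast hs.card_pos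
  rw [← sub_div, ← Finset.sum_sub_distrib, abs_div, abs_of_pos hc, div_le_iff₀ hc]
  calc |∑ i ∈ s, (f i - g i)| ≤ ∑ i ∈ s, |f i - g i| := Finset.abs_sum_le_sum_abs _ _
    _ ≤ s.card • C := Finset.sum_le_card_nsmul _ _ _ h
    _ = C * s.card := by rw [nsmul_eq_mul, mul_comm]

section

variable {U O : Type} [Fintype U] [DecidableEq O] {dplus : U → Finset O}

lemma abs_Rmap_sub_Rmap_le (w : U → O → ℝ) {α : ℝ} (hα : 0 ≤ α) (b c : U → ℝ) {j : O}
    (hj : (dminus dplus j).Nonempty) :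
    |Rmap dplus w α b j - Rmap dplus w α c j| ≤ α * dist b c := by
  refine abs_average_sub_average_le hj fun i _ => ?_
  calc |clamp (w i j - α * b i) - clamp (w i j - α * c i)|
      ≤ |w i j - α * b i - (w i j - α * c i)| := abs_clamp_sub_clamp_le _ _
    _ = α * dist (b i) (c i) := by
        rw [sub_sub_sub_cancel_left, ← mul_sub, abs_mul, abs_of_nonneg hα, dist_comm,
          Real.dist_eq]
    _ ≤ α * dist b c := mul_le_mul_of_nonneg_left (dist_le_pi_dist b c i) hα

lemma dist_Tmap_le (hd : ∀ i, (dplus i).Nonempty) (hdm : ∀ j, (dminus dplus j).Nonempty)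
    (w : U → O → ℝ) {α : ℝ} (hα : 0 ≤ α) (b c : U → ℝ) :
    dist (Tmap dplus w α b) (Tmap dplus w α c) ≤ α * dist b c := by
  refine (dist_pi_le_iff (mul_nonneg hα dist_nonneg)).2 fun i => ?_
  refine abs_average_sub_average_le (hd i) fun j _ => ?_
  rw [sub_sub_sub_cancel_left, abs_sub_comm]
  exact abs_Rmap_sub_Rmap_le w hα b c (hdm j)

end

theorem fixed_point_exists_unique
    {U O : Type} [Fintype U] [Nonempty U] [Fintype O] [Nonempty O] [DecidableEq O]
    (dplus : U → Finset O) (hd : ∀ i : U, (dplus i).Nonempty)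
    (hdm : ∀ j : O, (dminus dplus j).Nonempty)
    (w : U → O → ℝ) (hw : ∀ i j, w i j ∈ Set.Icc (0 : ℝ) 1)
    (α : ℝ) (hα0 : 0 < α) (hα1 : α < 1) :
    ∃! bstar : U → ℝ, Tmap dplus w α bstar = bstar := by
  have hT : ContractingWith ⟨α, hα0.le⟩ (Tmap dplus w α) :=
    ⟨hα1, LipschitzWith.of_dist_le_mul (dist_Tmap_le hd hdm w hα0.le)⟩
  exact ⟨hT.fixedPoint, hT.fixedPoint_isFixedPt, fun _ hb => hT.fixedPoint_unique hb⟩
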